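/- arXiv:2311.18283 — 2 statements merged into one kernel-verified Lean document; each statement's English description precedes it below -/
import Mathlib

section
/- Let 0 < α < 1, λ > 0, κ > 0 and M > 0. Let f : [0,∞) → [0,∞) be bounded measurable and let H : ℝ → ℝ be increasing and locally Lipschitz with H(x) = 0 for x ≤ 0. For γ > 0, let r_γ : [0,M] → ℝ be a continuous solution of the impact Volterra equation r_γ(t) = H(κ ∫₀ᵗ λ⁻¹ (t−s)^{−α} (γ f(s) − r_γ(s)) ds), and define the market impact MI(γ,t) = κ ∫₀ᵗ (1 + λ⁻¹ (t−s)^{−α}) (γ f(s) − r_γ(s)) ds. Then for all 0 < γ₁ ≤ γ₂ and all t ∈ [0,M], MI(γ₁,t) ≤ MI(γ₂,t); that is, γ ↦ MI(γ,t) is nondecreasing. -/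
open MeasureTheory Set Filter Topology

lemma setIntegral_Ioo_rpow_mul_rpow_pos {α : ℝ} (hα0 : 0 < α) (hα1 : α < 1) :
    0 < ∫ x in Ioo (0:ℝ) 1, x ^ (-α) * (1 - x) ^ (α - 1) := by
  have hb := ProbabilityTheory.beta_eq_betaIntegralReal (1 - α) α (by linarith) hα0
  have hpos := ProbabilityTheory.beta_pos (α := 1 - α) (β := α) (by linarith) hα0
  rw [hb] at hpos
  suffices h : Complex.betaIntegral ((1 - α : ℝ) : ℂ) α
      = ((∫ x in Ioo (0:ℝ) 1, x ^ (-α) * (1 - x) ^ (α - 1) : ℝ) : ℂ) by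
    rwa [h, Complex.ofReal_re] at hpos
  rw [Complex.betaIntegral, intervalIntegral.integral_of_le zero_le_one, integral_Ioc_eq_integral_Ioo,
    ← integral_complex_ofReal]
  refine setIntegral_congr_fun measurableSet_Ioo fun x hx => ?_
  have h1 : (0:ℝ) ≤ 1 - x := by linarith [hx.2]
  simp only [Complex.ofReal_mul, Complex.ofReal_cpow hx.1.le, Complex.ofReal_cpow h1]
  push_cast
  ring_nf

/-- The Beta integral transported to `(a, b)` by the affine change of variables. -/
lemma setIntegral_Ioo_rpow_sub_mul_rpow_sub {α a b : ℝ} (hab : a < b) :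
    ∫ s in Ioo a b, (s - a) ^ (-α) * (b - s) ^ (α - 1)
      = ∫ x in Ioo (0:ℝ) 1, x ^ (-α) * (1 - x) ^ (α - 1) := by
  have hba : 0 < b - a := sub_pos.2 hab
  have himg : (fun s => (s - a) / (b - a)) '' Ioo a b = Ioo (0:ℝ) 1 := by
    ext x
    constructor
    · rintro ⟨s, ⟨h1, h2⟩, rfl⟩
      exact ⟨div_pos (by linarith) hba, (div_lt_one hba).2 (by linarith)⟩
    · rintro ⟨h1, h2⟩
      refine ⟨a + x * (b - a), ⟨by nlinarith, by nlinarith⟩, ?_⟩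
      field_simp
      ring
  rw [← himg, integral_image_eq_integral_abs_deriv_smul (f' := fun _ => 1 / (b - a))
    measurableSet_Ioo
    (fun s _ => (((hasDerivAt_id' s).sub_const a).div_const (b - a)).hasDerivWithinAt)]
  · refine setIntegral_congr_fun measurableSet_Ioo fun s hs => ?_
    have h1 : 0 < s - a := sub_pos.2 hs.1
    have h2 : 0 < b - s := sub_pos.2 hs.2
    have h3 : 1 - (s - a) / (b - a) = (b - s) / (b - a) := by field_simp; ring
    simp only [smul_eq_mul, h3, abs_of_pos (one_div_pos.2 hba), Real.div_rpow h1.le hba.le,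
      Real.div_rpow h2.le hba.le, Real.rpow_sub_one hba.ne', Real.rpow_neg hba.le]
    have := (Real.rpow_pos_of_pos hba α).ne'
    field_simp
  · intro x _ y _ hxy
    simpa [div_left_inj' hba.ne'] using hxy

/-- The Beta integral transported to `(a, b)` by the Möbius map sending `a, b, t` to `0, 1, ∞`. -/
lemma setIntegral_Ioo_rpow_sub_mul_rpow_sub_div {α a b t : ℝ} (hab : a < b) (hbt : b < t) :
    ∫ s in Ioo a b, (s - a) ^ (-α) * ((b - s) ^ (α - 1) / (t - s))
      = (∫ x in Ioo (0:ℝ) 1, x ^ (-α) * (1 - x) ^ (α - 1))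
        * (t - b) ^ (α - 1) * (t - a) ^ (-α) := by
  have hba : 0 < b - a := sub_pos.2 hab
  have htb : 0 < t - b := sub_pos.2 hbt
  have hta : 0 < t - a := by linarith
  have himg : (fun s => (s - a) * (t - b) / ((t - s) * (b - a))) '' Ioo a b = Ioo (0:ℝ) 1 := by
    ext x
    constructor
    · rintro ⟨s, ⟨h1, h2⟩, rfl⟩
      have hd : 0 < (t - s) * (b - a) := mul_pos (by linarith) hba
      exact ⟨div_pos (mul_pos (by linarith) htb) hd, (div_lt_one hd).2 (by nlinarith)⟩
    · rintro ⟨h1, h2⟩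
      have hd : 0 < (t - b) + x * (b - a) := by positivity
      refine ⟨(a * (t - b) + x * (b - a) * t) / ((t - b) + x * (b - a)),
        ⟨(lt_div_iff₀ hd).2 ?_, (div_lt_iff₀ hd).2 ?_⟩, ?_⟩
      · nlinarith [mul_pos (mul_pos h1 hba) hta]
      · nlinarith [mul_pos (mul_pos (sub_pos.2 h2) hba) htb]
      · have e1 : (a * (t - b) + x * (b - a) * t) / ((t - b) + x * (b - a)) - a
            = x * (b - a) * (t - a) / ((t - b) + x * (b - a)) := by field_simp; ring
        have e2 : t - (a * (t - b) + x * (b - a) * t) / ((t - b) + x * (b - a))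
            = (t - b) * (t - a) / ((t - b) + x * (b - a)) := by field_simp; ring
        simp only [e1, e2]
        field_simp
  rw [← himg, integral_image_eq_integral_abs_deriv_smul
    (f' := fun s => (t - b) * (t - a) / ((t - s) ^ 2 * (b - a))) measurableSet_Ioo]
  · rw [← integral_mul_const, ← integral_mul_const]
    refine setIntegral_congr_fun measurableSet_Ioo fun s hs => ?_
    have h1 : 0 < s - a := sub_pos.2 hs.1
    have h2 : 0 < b - s := sub_pos.2 hs.2
    have h4 : 0 < t - s := by linarith
    have h3 : 1 - (s - a) * (t - b) / ((t - s) * (b - a))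
        = (b - s) * (t - a) / ((t - s) * (b - a)) := by field_simp; ring
    have hJ : 0 < (t - b) * (t - a) / ((t - s) ^ 2 * (b - a)) := by positivity
    simp only [smul_eq_mul, h3, abs_of_pos hJ]
    rw [Real.div_rpow (by positivity) (by positivity), Real.div_rpow (by positivity) (by positivity),
      Real.mul_rpow h1.le htb.le, Real.mul_rpow h4.le hba.le, Real.mul_rpow h2.le hta.le,
      Real.mul_rpow h4.le hba.le]
    simp only [Real.rpow_sub_one hba.ne', Real.rpow_neg hba.le, Real.rpow_sub_one hta.ne',
      Real.rpow_neg hta.le, Real.rpow_sub_one htb.ne', Real.rpow_neg htb.le,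
      Real.rpow_sub_one h4.ne', Real.rpow_neg h4.le, Real.rpow_sub_one h2.ne',
      Real.rpow_neg h1.le]
    have := (Real.rpow_pos_of_pos hba α).ne'
    have := (Real.rpow_pos_of_pos hta α).ne'
    have := (Real.rpow_pos_of_pos htb α).ne'
    have := (Real.rpow_pos_of_pos h4 α).ne'
    have := (Real.rpow_pos_of_pos h2 α).ne'
    have := (Real.rpow_pos_of_pos h1 α).ne'
    field_simp
  · intro s hs
    have h4 : t - s ≠ 0 := by linarith [hs.2]
    have hd : (t - s) * (b - a) ≠ 0 := mul_ne_zero h4 hba.ne'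
    have := ((((hasDerivAt_id s).sub_const a).mul_const (t - b)).div
      (((hasDerivAt_id s).const_sub t).mul_const (b - a)) hd)
    refine (this.congr_deriv ?_).hasDerivWithinAt
    simp only [id]
    field_simp
    ring
  · intro x hx y hy hxy
    have h1 : 0 < t - x := by linarith [hx.2]
    have h2 : 0 < t - y := by linarith [hy.2]
    simp only at hxy
    rw [div_eq_div_iff (by positivity) (by positivity)] at hxy
    have : (x - y) * ((t - b) * (b - a) * (t - a)) = 0 := by linear_combination hxy
    have hne : (t - b) * (b - a) * (t - a) ≠ 0 := by positivity
    linarith [(mul_eq_zero.1 this).resolve_right hne]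

lemma intervalIntegrable_rpow_sub {α : ℝ} (hα1 : α < 1) (a b t : ℝ) :
    IntervalIntegrable (fun s => (t - s) ^ (-α)) volume a b := by
  have := (intervalIntegral.intervalIntegrable_rpow' (r := -α) (by linarith)
    (a := t - a) (b := t - b)).comp_sub_left t
  simpa using this

lemma intervalIntegrable_rpow_sub_mul {α C : ℝ} (hα1 : α < 1) {h : ℝ → ℝ} (hm : Measurable h)
    (hC : ∀ s, |h s| ≤ C) (a b t : ℝ) :
    IntervalIntegrable (fun s => (t - s) ^ (-α) * h s) volume a b := by
  rw [intervalIntegrable_iff]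
  exact (intervalIntegrable_iff.1 (intervalIntegrable_rpow_sub hα1 a b t)).mul_bdd (c := C)
    hm.aestronglyMeasurable (ae_of_all _ hC)

lemma intervalIntegral_rpow_sub {α : ℝ} (hα1 : α < 1) (a b t : ℝ) :
    ∫ s in a..b, (t - s) ^ (-α) = ((t - a) ^ (1 - α) - (t - b) ^ (1 - α)) / (1 - α) := by
  rw [intervalIntegral.integral_comp_sub_left (fun x => x ^ (-α)) t,
    integral_rpow (Or.inl (by linarith))]
  ring_nf

lemma abs_intervalIntegral_rpow_sub_mul_le {α C : ℝ} (hα1 : α < 1) {h : ℝ → ℝ}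
    (hC : ∀ s, |h s| ≤ C) {a b : ℝ} (hab : a ≤ b) :
    |∫ s in a..b, (b - s) ^ (-α) * h s| ≤ C * ((b - a) ^ (1 - α) / (1 - α)) := by
  have hne : (1 - α) ≠ 0 := by linarith
  have := intervalIntegral.norm_integral_le_of_norm_le (μ := volume)
    (f := fun s => (b - s) ^ (-α) * h s) (g := fun s => C * (b - s) ^ (-α)) hab
    (ae_of_all _ fun s hs => ?_) ((intervalIntegrable_rpow_sub hα1 a b b).const_mul C)
  · rw [intervalIntegral.integral_const_mul, intervalIntegral_rpow_sub hα1, sub_self,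
      Real.zero_rpow hne, sub_zero] at this
    exact this
  · have h0 : 0 ≤ (b - s) ^ (-α) := Real.rpow_nonneg (by linarith [hs.2]) _
    rw [Real.norm_eq_abs, abs_mul, abs_of_nonneg h0, mul_comm]
    exact mul_le_mul_of_nonneg_right (hC s) h0

/-- Abel integrals of bounded functions are Hölder continuous. -/
lemma abs_abelIntegral_sub_le {α C : ℝ} (hα0 : 0 < α) (hα1 : α < 1) {h : ℝ → ℝ}
    (hm : Measurable h) (hC : ∀ s, |h s| ≤ C) {a b : ℝ} (ha : 0 ≤ a) (hab : a ≤ b) :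
    |(∫ s in (0:ℝ)..b, (b - s) ^ (-α) * h s) - ∫ s in (0:ℝ)..a, (a - s) ^ (-α) * h s|
      ≤ 2 * C / (1 - α) * (b - a) ^ (1 - α) := by
  have hC0 : 0 ≤ C := (abs_nonneg _).trans (hC 0)
  have h1α : 0 < 1 - α := by linarith
  have hI := intervalIntegrable_rpow_sub_mul hα1 hm hC
  have hsplit : (∫ s in (0:ℝ)..b, (b - s) ^ (-α) * h s)
      - ∫ s in (0:ℝ)..a, (a - s) ^ (-α) * h s
      = (∫ s in (0:ℝ)..a, ((b - s) ^ (-α) * h s - (a - s) ^ (-α) * h s))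
        + ∫ s in a..b, (b - s) ^ (-α) * h s := by
    rw [← intervalIntegral.integral_add_adjacent_intervals (hI 0 a b) (hI a b b),
      intervalIntegral.integral_sub (hI 0 a b) (hI 0 a a)]
    ring
  have hfst := intervalIntegral.norm_integral_le_of_norm_le (μ := volume)
    (f := fun s => (b - s) ^ (-α) * h s - (a - s) ^ (-α) * h s)
    (g := fun s => C * ((a - s) ^ (-α) - (b - s) ^ (-α))) ha ?_
    (((intervalIntegrable_rpow_sub hα1 0 a a).sub
      (intervalIntegrable_rpow_sub hα1 0 a b)).const_mul C)
  · rw [intervalIntegral.integral_const_mul, intervalIntegral.integral_sub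
      (intervalIntegrable_rpow_sub hα1 0 a a) (intervalIntegrable_rpow_sub hα1 0 a b),
      intervalIntegral_rpow_sub hα1, intervalIntegral_rpow_sub hα1, sub_self,
      Real.zero_rpow h1α.ne', sub_zero, sub_zero, sub_zero, Real.norm_eq_abs] at hfst
    have hsnd := abs_intervalIntegral_rpow_sub_mul_le hα1 hC hab
    have hmono : a ^ (1 - α) ≤ b ^ (1 - α) := Real.rpow_le_rpow ha hab h1α.le
    rw [hsplit]
    refine (abs_add_le _ _).trans ((add_le_add hfst hsnd).trans ?_)
    rw [← mul_add, ← sub_div, ← add_div, mul_div_assoc', div_mul_eq_mul_div]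
    refine div_le_div_of_nonneg_right ?_ h1α.le
    linarith [mul_le_mul_of_nonneg_left hmono hC0]
  · filter_upwards [Measure.ae_ne volume a] with s hsa hs
    have hlt : 0 < a - s := sub_pos.2 (lt_of_le_of_ne hs.2 hsa)
    have hle : (b - s) ^ (-α) ≤ (a - s) ^ (-α) :=
      Real.rpow_le_rpow_of_nonpos hlt (by linarith) (by linarith)
    rw [Real.norm_eq_abs, ← sub_mul, abs_mul, abs_sub_comm, abs_of_nonneg (by linarith), mul_comm]
    exact mul_le_mul_of_nonneg_right (hC s) (by linarith)

lemma continuousOn_abelIntegral {α C : ℝ} (hα0 : 0 < α) (hα1 : α < 1) {h : ℝ → ℝ}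
    (hm : Measurable h) (hC : ∀ s, |h s| ≤ C) :
    ContinuousOn (fun t => ∫ s in (0:ℝ)..t, (t - s) ^ (-α) * h s) (Ici 0) := by
  intro a ha
  have hlim : Tendsto (fun b => 2 * C / (1 - α) * |b - a| ^ (1 - α)) (𝓝[Ici 0] a) (𝓝 0) := by
    have hc : Continuous fun b : ℝ => 2 * C / (1 - α) * |b - a| ^ (1 - α) :=
      continuous_const.mul ((continuous_id.sub continuous_const).abs.rpow_const
        fun _ => Or.inr (by linarith))
    have := (hc.tendsto a).mono_left (nhdsWithin_le_nhds (s := Ici 0))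
    simpa [Real.zero_rpow (by linarith : 1 - α ≠ 0)] using this
  refine tendsto_iff_norm_sub_tendsto_zero.2 (squeeze_zero' (.of_forall fun _ => norm_nonneg _) ?_ hlim)
  filter_upwards [self_mem_nhdsWithin] with b hb
  rcases le_total a b with hab | hab
  · rw [abs_of_nonneg (sub_nonneg.2 hab)]
    exact abs_abelIntegral_sub_le hα0 hα1 hm hC ha hab
  · rw [abs_sub_comm b a, abs_of_nonneg (sub_nonneg.2 hab), norm_sub_rev]
    exact abs_abelIntegral_sub_le hα0 hα1 hm hC hb hab

/-- Fubini's theorem for an Abel integral tested against an integrable weight. -/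
lemma integral_mul_abelIntegral {α C T : ℝ} (hα1 : α < 1) {h w : ℝ → ℝ}
    (hm : Measurable h) (hC : ∀ s, |h s| ≤ C) (hwm : Measurable w) (hw : IntegrableOn w (Ioo 0 T)) :
    ∫ s in Ioo 0 T, w s * ∫ u in (0:ℝ)..s, (s - u) ^ (-α) * h u
      = ∫ u in Ioo 0 T, h u * ∫ s in Ioo u T, (s - u) ^ (-α) * w s := by
  have hC0 : 0 ≤ C := (abs_nonneg _).trans (hC 0)
  have h1α : 0 < 1 - α := by linarith
  set F : ℝ → ℝ → ℝ := fun u s => if u < s then w s * ((s - u) ^ (-α) * h u) else 0 with hF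
  have hFm : Measurable (Function.uncurry F) := by
    refine Measurable.ite (measurableSet_lt measurable_fst measurable_snd) ?_ measurable_const
    fun_prop
  have hsec : ∀ s, (fun u => F u s) = (Iio s).indicator fun u => w s * ((s - u) ^ (-α) * h u) :=
    fun s => by ext u; simp [hF, indicator]
  have hsec' : ∀ u, (fun s => F u s) = (Ioi u).indicator fun s => w s * ((s - u) ^ (-α) * h u) :=
    fun s => by ext u; simp [hF, indicator]
  have hIoo : ∀ s, 0 < s → IntegrableOn (fun u => w s * ((s - u) ^ (-α) * h u)) (Ioo 0 s) :=
    fun s hs => ((intervalIntegrable_iff_integrableOn_Ioo_of_le hs.le).1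
      (intervalIntegrable_rpow_sub_mul hα1 hm hC 0 s s)).const_mul _
  have hint : Integrable (Function.uncurry F)
      ((volume.restrict (Ioo 0 T)).prod (volume.restrict (Ioo 0 T))) := by
    rw [integrable_prod_iff' hFm.aestronglyMeasurable]
    constructor
    · filter_upwards [ae_restrict_mem measurableSet_Ioo] with s hs
      simp only [Function.uncurry]
      rw [hsec, integrable_indicator_iff measurableSet_Iio, IntegrableOn,
        Measure.restrict_restrict measurableSet_Iio, inter_comm, Ioo_inter_Iio, min_eq_right hs.2.le]
      exact hIoo s hs.1
    · refine (hw.norm.mul_const (C * (T ^ (1 - α) / (1 - α)))).mono'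
        hFm.norm.aestronglyMeasurable.prod_swap.integral_prod_right' ?_
      filter_upwards [ae_restrict_mem measurableSet_Ioo] with s hs
      have hnorm : (fun u => ‖F u s‖)
          = (Iio s).indicator fun u => ‖w s‖ * ‖(s - u) ^ (-α) * h u‖ := by
        ext u
        by_cases hus : u < s <;> simp [hF, indicator, hus]
      rw [Real.norm_of_nonneg (integral_nonneg fun _ => norm_nonneg _)]
      simp only [Function.uncurry]
      rw [hnorm, setIntegral_indicator measurableSet_Iio, Ioo_inter_Iio, min_eq_right hs.2.le,
        integral_const_mul]
      refine mul_le_mul_of_nonneg_left ?_ (norm_nonneg _)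
      have hle := abs_intervalIntegral_rpow_sub_mul_le (α := α) (h := fun u => |h u|) hα1
        (fun u => (abs_abs (h u)).trans_le (hC u)) hs.1.le
      rw [intervalIntegral.integral_of_le hs.1.le, integral_Ioc_eq_integral_Ioo, sub_zero] at hle
      calc ∫ u in Ioo 0 s, ‖(s - u) ^ (-α) * h u‖
          = ∫ u in Ioo 0 s, (s - u) ^ (-α) * |h u| :=
            setIntegral_congr_fun measurableSet_Ioo fun u hu => by
              simp [abs_of_nonneg (Real.rpow_nonneg (sub_nonneg.2 hu.2.le) (-α))]
        _ ≤ C * (s ^ (1 - α) / (1 - α)) := (le_abs_self _).trans hle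
        _ ≤ C * (T ^ (1 - α) / (1 - α)) := by
            have := Real.rpow_le_rpow hs.1.le hs.2.le h1α.le
            gcongr
  have hswap := integral_integral_swap hint
  calc ∫ s in Ioo 0 T, w s * ∫ u in (0:ℝ)..s, (s - u) ^ (-α) * h u
      = ∫ s in Ioo 0 T, ∫ u in Ioo 0 T, F u s := by
        refine setIntegral_congr_fun measurableSet_Ioo fun s hs => ?_
        rw [hsec, setIntegral_indicator measurableSet_Iio, Ioo_inter_Iio, min_eq_right hs.2.le,
          integral_const_mul, intervalIntegral.integral_of_le hs.1.le, integral_Ioc_eq_integral_Ioo]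
    _ = ∫ u in Ioo 0 T, ∫ s in Ioo 0 T, F u s := hswap.symm
    _ = _ := by
        refine setIntegral_congr_fun measurableSet_Ioo fun u hu => ?_
        rw [hsec', setIntegral_indicator measurableSet_Ioi, inter_comm, Ioi_inter_Ioo,
          max_eq_left hu.1.le, ← integral_const_mul]
        refine integral_congr_ae (ae_of_all _ fun s => ?_)
        simp only
        ring

/-- A maximum principle for Abel integrals: if the density is nonnegative wherever its Abel
integral is nonpositive, then the Abel integral is nonnegative. -/
lemma abelIntegral_nonneg {α C M : ℝ} (hα0 : 0 < α) (hα1 : α < 1) (hM : 0 ≤ M) {h : ℝ → ℝ}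
    (hm : Measurable h) (hC : ∀ s, |h s| ≤ C)
    (hsign : ∀ t ∈ Icc (0:ℝ) M, (∫ s in (0:ℝ)..t, (t - s) ^ (-α) * h s) ≤ 0 → 0 ≤ h t) :
    ∀ t ∈ Icc (0:ℝ) M, 0 ≤ ∫ s in (0:ℝ)..t, (t - s) ^ (-α) * h s := by
  set Z : ℝ → ℝ := fun t => ∫ s in (0:ℝ)..t, (t - s) ^ (-α) * h s with hZ
  have hZc : ContinuousOn Z (Ici 0) := continuousOn_abelIntegral hα0 hα1 hm hC
  have hI := intervalIntegrable_rpow_sub_mul hα1 hm hC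
  obtain ⟨t, ht, hmin⟩ := isCompact_Icc.exists_isMinOn (nonempty_Icc.2 hM)
    (hZc.mono (Icc_subset_Ici_self : Icc 0 M ⊆ Ici 0))
  suffices hnn : 0 ≤ Z t from fun s hs => hnn.trans (hmin hs)
  by_contra! hneg
  have hcpt : IsCompact (Icc 0 t ∩ Z ⁻¹' Ici 0) :=
    isCompact_Icc.of_isClosed_subset ((hZc.mono Icc_subset_Ici_self).preimage_isClosed_of_isClosed
      isClosed_Icc isClosed_Ici) inter_subset_left
  obtain ⟨T, ⟨⟨hT0, hTt⟩, hZT⟩, hTmax⟩ :=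
    hcpt.exists_isGreatest ⟨0, ⟨le_rfl, ht.1⟩, by simp [hZ]⟩
  have hTt : T < t := hTt.lt_of_ne fun he => absurd (he ▸ hZT : Z t ∈ Ici 0) (not_le.2 hneg)
  have hpos : 0 ≤ ∫ s in T..t, (t - s) ^ (-α) * h s := by
    rw [intervalIntegral.integral_of_le hTt.le]
    refine setIntegral_nonneg measurableSet_Ioc fun s hs => ?_
    have hsM : s ∈ Icc 0 M := ⟨hT0.trans hs.1.le, hs.2.trans ht.2⟩
    refine mul_nonneg (Real.rpow_nonneg (sub_nonneg.2 hs.2) _) (hsign s hsM ?_)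
    by_contra! hcon
    exact absurd (hTmax ⟨⟨hsM.1, hs.2⟩, hcon.le⟩) (not_le.2 hs.1)
  have hWZ : (∫ s in (0:ℝ)..T, (t - s) ^ (-α) * h s) ≤ Z t := by
    rw [hZ]
    simp only
    rw [← intervalIntegral.integral_add_adjacent_intervals (hI 0 T t) (hI T t t)]
    linarith
  rcases hT0.eq_or_lt with rfl | hT
  · rw [intervalIntegral.integral_same] at hWZ
    linarith
  have htpos : 0 < t := hT.trans hTt
  set B := ∫ x in Ioo (0:ℝ) 1, x ^ (-α) * (1 - x) ^ (α - 1) with hB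
  have hBpos : 0 < B := setIntegral_Ioo_rpow_mul_rpow_pos hα0 hα1
  set w : ℝ → ℝ := fun s => (T - s) ^ (α - 1) / (t - s) with hw
  have hD : 0 < B * (t - T) ^ (α - 1) := mul_pos hBpos (Real.rpow_pos_of_pos (sub_pos.2 hTt) _)
  have hq : ∀ u < T, ∫ s in Ioo u T, (s - u) ^ (-α) * w s
      = B * (t - T) ^ (α - 1) * (t - u) ^ (-α) :=
    fun u hu => setIntegral_Ioo_rpow_sub_mul_rpow_sub_div hu hTt
  have hw0 : ∀ s ∈ Ioo 0 T, 0 ≤ w s := fun s hs =>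
    div_nonneg (Real.rpow_nonneg (by linarith [hs.2]) _) (by linarith [hs.2])
  have hwm : Measurable w := by fun_prop
  have hq0 := hq 0 hT
  simp only [sub_zero] at hq0
  have hqint : IntegrableOn (fun s => s ^ (-α) * w s) (Ioo 0 T) := by
    refine Integrable.of_integral_ne_zero ?_
    rw [hq0]
    exact (mul_pos hD (Real.rpow_pos_of_pos htpos _)).ne'
  have hTα : 0 < T ^ (-α) := Real.rpow_pos_of_pos hT _
  have hwle : ∀ s ∈ Ioo 0 T, T ^ (-α) * w s ≤ s ^ (-α) * w s := fun s hs =>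
    mul_le_mul_of_nonneg_right
      (Real.rpow_le_rpow_of_nonpos hs.1 hs.2.le (by linarith)) (hw0 s hs)
  have hwint : IntegrableOn w (Ioo 0 T) := by
    have : IntegrableOn (fun s => T ^ (-α) * w s) (Ioo 0 T) := by
      refine hqint.mono' (by fun_prop) ?_
      filter_upwards [ae_restrict_mem measurableSet_Ioo] with s hs
      rw [Real.norm_of_nonneg (mul_nonneg hTα.le (hw0 s hs))]
      exact hwle s hs
    exact (integrable_const_mul_iff (isUnit_iff_ne_zero.2 hTα.ne') w).1 this
  have hwmass : T ^ (-α) * ∫ s in Ioo 0 T, w s ≤ B * (t - T) ^ (α - 1) * t ^ (-α) := by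
    rw [← hq0, ← integral_const_mul]
    exact setIntegral_mono_on (hwint.const_mul _) hqint measurableSet_Ioo hwle
  have hfub : ∫ s in Ioo 0 T, w s * Z s
      = B * (t - T) ^ (α - 1) * ∫ u in (0:ℝ)..T, (t - u) ^ (-α) * h u := by
    rw [hZ, integral_mul_abelIntegral hα1 hm hC hwm hwint, intervalIntegral.integral_of_le hT0,
      integral_Ioc_eq_integral_Ioo, ← integral_const_mul]
    refine setIntegral_congr_fun measurableSet_Ioo fun u hu => ?_
    simp only [hq u hu.2]
    ring
  have hZsub : ContinuousOn Z (Icc 0 T) := hZc.mono Icc_subset_Ici_self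
  obtain ⟨K, hK⟩ := isCompact_Icc.exists_bound_of_continuousOn hZsub
  have hwZint : IntegrableOn (fun s => w s * Z s) (Ioo 0 T) := by
    refine Integrable.mul_bdd (c := K) hwint
      ((hZsub.mono Ioo_subset_Icc_self).aestronglyMeasurable measurableSet_Ioo) ?_
    filter_upwards [ae_restrict_mem measurableSet_Ioo] with s hs using hK s (Ioo_subset_Icc_self hs)
  have hlow : (∫ s in Ioo 0 T, w s) * Z t ≤ ∫ s in Ioo 0 T, w s * Z s := by
    rw [← integral_mul_const]
    refine setIntegral_mono_on (hwint.mul_const _) hwZint measurableSet_Ioo fun s hs => ?_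
    exact mul_le_mul_of_nonneg_left (hmin ⟨hs.1.le, by linarith [hs.2, ht.2]⟩) (hw0 s hs)
  have hlt : t ^ (-α) < T ^ (-α) := Real.rpow_lt_rpow_of_neg hT hTt (by linarith)
  have hmass_lt : ∫ s in Ioo 0 T, w s < B * (t - T) ^ (α - 1) := by
    refine lt_of_mul_lt_mul_left ?_ hTα.le
    calc _ ≤ _ := hwmass
      _ < _ := by rw [mul_comm]; exact mul_lt_mul_of_pos_right hlt hD
  have h1 := mul_lt_mul_of_neg_right hmass_lt hneg
  have h2 := mul_le_mul_of_nonneg_left hWZ hD.le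
  rw [← hfub] at h2
  linarith

/-- Abel inversion: a density with nonnegative Abel integral has nonnegative primitive. -/
lemma integral_nonneg_of_abelIntegral_nonneg {α C T : ℝ} (hα0 : 0 < α) (hα1 : α < 1)
    (hT : 0 ≤ T) {h : ℝ → ℝ} (hm : Measurable h) (hC : ∀ s, |h s| ≤ C)
    (hZ : ∀ t ∈ Icc (0:ℝ) T, 0 ≤ ∫ s in (0:ℝ)..t, (t - s) ^ (-α) * h s) :
    0 ≤ ∫ s in (0:ℝ)..T, h s := by
  have hwm : Measurable fun s : ℝ => (T - s) ^ (α - 1) := by fun_prop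
  have hwint : IntegrableOn (fun s => (T - s) ^ (α - 1)) (Ioo 0 T) := by
    have := intervalIntegrable_rpow_sub (α := 1 - α) (by linarith) 0 T T
    rw [neg_sub] at this
    exact (intervalIntegrable_iff_integrableOn_Ioo_of_le hT).1 this
  have hfub := integral_mul_abelIntegral hα1 hm hC hwm hwint
  have hnn : 0 ≤ ∫ s in Ioo 0 T, (T - s) ^ (α - 1) * ∫ u in (0:ℝ)..s, (s - u) ^ (-α) * h u :=
    setIntegral_nonneg measurableSet_Ioo fun s hs =>
      mul_nonneg (Real.rpow_nonneg (by linarith [hs.2]) _) (hZ s (Ioo_subset_Icc_self hs))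
  rw [hfub, setIntegral_congr_fun measurableSet_Ioo (g := fun u =>
    h u * ∫ x in Ioo (0:ℝ) 1, x ^ (-α) * (1 - x) ^ (α - 1)) fun u hu => by
      simp only [setIntegral_Ioo_rpow_sub_mul_rpow_sub hu.2], integral_mul_const] at hnn
  rw [intervalIntegral.integral_of_le hT, integral_Ioc_eq_integral_Ioo]
  exact nonneg_of_mul_nonneg_left hnn (setIntegral_Ioo_rpow_mul_rpow_pos hα0 hα1)

/-- A continuous perturbation of a bounded measurable function on `[0, M]` extends to a bounded
measurable function on the line. -/
lemma exists_bounded_measurable_extension {M C c : ℝ} (hM : 0 ≤ M) {f r : ℝ → ℝ}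
    (hf : Measurable f) (hf0 : ∀ t, 0 ≤ t → 0 ≤ f t) (hfC : ∀ t, 0 ≤ t → f t ≤ C)
    (hr : ContinuousOn r (Icc 0 M)) :
    ∃ h : ℝ → ℝ, Measurable h ∧ (∃ D, ∀ s, |h s| ≤ D) ∧ ∀ s ∈ Icc 0 M, h s = c * f s - r s := by
  obtain ⟨K, hK⟩ := isCompact_Icc.exists_bound_of_continuousOn hr
  have hC0 : 0 ≤ C := (hf0 0 le_rfl).trans (hfC 0 le_rfl)
  have hK0 : 0 ≤ K := (norm_nonneg _).trans (hK 0 ⟨le_rfl, hM⟩)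
  classical
  refine ⟨(Icc 0 M).piecewise
    (fun s => c * f s - IccExtend hM ((Icc 0 M).domRestrict r) s) 0, ?_, ?_, ?_⟩
  · have hcont : Continuous (IccExtend hM ((Icc 0 M).domRestrict r)) :=
      (continuousOn_iff_continuous_domRestrict.1 hr).Icc_extend'
    exact Measurable.piecewise measurableSet_Icc ((hf.const_mul c).sub hcont.measurable)
      measurable_const
  · refine ⟨|c| * C + K, fun s => ?_⟩
    by_cases hs : s ∈ Icc 0 M
    · rw [piecewise_eq_of_mem _ _ _ hs, IccExtend_of_mem _ _ hs]
      refine (abs_sub _ _).trans (add_le_add ?_ (hK s hs))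
      rw [abs_mul, abs_of_nonneg (hf0 s hs.1)]
      exact mul_le_mul_of_nonneg_left (hfC s hs.1) (abs_nonneg c)
    · rw [piecewise_eq_of_notMem _ _ _ hs]
      simp only [Pi.zero_apply, abs_zero]
      positivity
  · intro s hs
    rw [piecewise_eq_of_mem _ _ _ hs, IccExtend_of_mem _ _ hs]
    rfl

/-- Monotonicity of the macroscopic market impact in the participation rate:
for `γ₁ ≤ γ₂`, `MI(γ₁, t) ≤ MI(γ₂, t)` for all `t ∈ [0, M]`. -/
theorem stmt_10
    (α lam κ M : ℝ) (hα0 : 0 < α) (hα1 : α < 1) (hlam : 0 < lam)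
    (hκ : 0 < κ) (hM : 0 < M)
    (f : ℝ → ℝ) (hf_meas : Measurable f)
    (hf_nonneg : ∀ t, 0 ≤ t → 0 ≤ f t)
    (hf_bdd : ∃ C, ∀ t, 0 ≤ t → f t ≤ C)
    (H : ℝ → ℝ) (hH_mono : Monotone H) (hH_lip : LocallyLipschitz H)
    (hH_zero : ∀ x, x ≤ 0 → H x = 0)
    (γ₁ γ₂ : ℝ) (hγ₁ : 0 < γ₁) (hγ₁₂ : γ₁ ≤ γ₂)
    (r₁ r₂ : ℝ → ℝ)
    (hr₁_cont : ContinuousOn r₁ (Icc 0 M))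
    (hr₂_cont : ContinuousOn r₂ (Icc 0 M))
    (hr₁ : ∀ t ∈ Icc (0:ℝ) M,
      r₁ t = H (κ * ∫ s in (0:ℝ)..t, lam⁻¹ * (t - s) ^ (-α) * (γ₁ * f s - r₁ s)))
    (hr₂ : ∀ t ∈ Icc (0:ℝ) M,
      r₂ t = H (κ * ∫ s in (0:ℝ)..t, lam⁻¹ * (t - s) ^ (-α) * (γ₂ * f s - r₂ s))) :
    ∀ t ∈ Icc (0:ℝ) M,
      κ * (∫ s in (0:ℝ)..t, (1 + lam⁻¹ * (t - s) ^ (-α)) * (γ₁ * f s - r₁ s))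
        ≤ κ * ∫ s in (0:ℝ)..t, (1 + lam⁻¹ * (t - s) ^ (-α)) * (γ₂ * f s - r₂ s) := by
  intro t ht
  obtain ⟨C, hfC⟩ := hf_bdd
  have hext := fun (c : ℝ) (r : ℝ → ℝ) (hr : ContinuousOn r (Icc 0 M)) =>
    exists_bounded_measurable_extension (c := c) hM.le hf_meas hf_nonneg hfC hr
  obtain ⟨h₁, hm₁, ⟨D₁, hD₁⟩, he₁⟩ := hext γ₁ r₁ hr₁_cont
  obtain ⟨h₂, hm₂, ⟨D₂, hD₂⟩, he₂⟩ := hext γ₂ r₂ hr₂_cont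
  have hcongr : ∀ (k g h : ℝ → ℝ), (∀ s ∈ Icc 0 M, h s = g s) → ∀ t ∈ Icc 0 M,
      ∫ s in (0:ℝ)..t, k s * g s = ∫ s in (0:ℝ)..t, k s * h s := by
    intro k g h hgh t ht
    refine intervalIntegral.integral_congr fun s hs => ?_
    rw [uIcc_of_le ht.1] at hs
    simp only [hgh s ⟨hs.1, hs.2.trans ht.2⟩]
  have hI₁ := intervalIntegrable_rpow_sub_mul hα1 hm₁ hD₁
  have hI₂ := intervalIntegrable_rpow_sub_mul hα1 hm₂ hD₂
  have hmd : Measurable fun s => h₂ s - h₁ s := hm₂.sub hm₁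
  have hDd : ∀ s, |h₂ s - h₁ s| ≤ D₂ + D₁ := fun s =>
    (abs_sub _ _).trans (add_le_add (hD₂ s) (hD₁ s))
  have hsub : ∀ t, ∫ s in (0:ℝ)..t, (t - s) ^ (-α) * (h₂ s - h₁ s)
      = (∫ s in (0:ℝ)..t, (t - s) ^ (-α) * h₂ s) - ∫ s in (0:ℝ)..t, (t - s) ^ (-α) * h₁ s := by
    intro t
    simp only [mul_sub]
    exact intervalIntegral.integral_sub (hI₂ 0 t t) (hI₁ 0 t t)
  have hZ : ∀ t ∈ Icc (0:ℝ) M, 0 ≤ ∫ s in (0:ℝ)..t, (t - s) ^ (-α) * (h₂ s - h₁ s) := by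
    refine abelIntegral_nonneg hα0 hα1 hM.le hmd hDd fun t ht hle => ?_
    rw [hsub, sub_nonpos] at hle
    have hr : r₂ t ≤ r₁ t := by
      rw [hr₁ t ht, hr₂ t ht]
      refine hH_mono (mul_le_mul_of_nonneg_left ?_ hκ.le)
      rw [hcongr _ _ _ he₁ t ht, hcongr _ _ _ he₂ t ht]
      simp only [mul_assoc, intervalIntegral.integral_const_mul]
      exact mul_le_mul_of_nonneg_left hle (inv_pos.2 hlam).le
    rw [he₁ t ht, he₂ t ht]
    linarith [mul_le_mul_of_nonneg_right hγ₁₂ (hf_nonneg t ht.1)]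
  have hprim := integral_nonneg_of_abelIntegral_nonneg hα0 hα1 ht.1 hmd hDd
    fun s hs => hZ s ⟨hs.1, hs.2.trans ht.2⟩
  have hii : ∀ {h : ℝ → ℝ} {D : ℝ}, Measurable h → (∀ s, |h s| ≤ D) →
      IntervalIntegrable h volume 0 t := fun hm hD =>
    (intervalIntegrable_const (c := _)).mono_fun' hm.aestronglyMeasurable (ae_of_all _ hD)
  have hMI : ∀ {h : ℝ → ℝ} {D : ℝ}, Measurable h → (∀ s, |h s| ≤ D) →
      ∫ s in (0:ℝ)..t, (1 + lam⁻¹ * (t - s) ^ (-α)) * h s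
        = (∫ s in (0:ℝ)..t, h s) + lam⁻¹ * ∫ s in (0:ℝ)..t, (t - s) ^ (-α) * h s := by
    intro h D hm hD
    simp only [add_mul, one_mul, mul_assoc]
    rw [intervalIntegral.integral_add (hii hm hD)
      ((intervalIntegrable_rpow_sub_mul hα1 hm hD 0 t t).const_mul _),
      intervalIntegral.integral_const_mul]
  refine mul_le_mul_of_nonneg_left ?_ hκ.le
  rw [hcongr _ _ _ he₁ t ht, hcongr _ _ _ he₂ t ht, hMI hm₁ hD₁, hMI hm₂ hD₂]
  have hZt := hZ t ht
  rw [hsub, sub_nonneg] at hZt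
  rw [intervalIntegral.integral_sub (hii hm₂ hD₂) (hii hm₁ hD₁), sub_nonneg] at hprim
  exact add_le_add hprim (mul_le_mul_of_nonneg_left hZt (inv_pos.2 hlam).le)
end

section
/- Let 0 < α < 1, λ > 0, κ > 0 and M > 0. Let f : [0,∞) → [0,∞) be bounded measurable and let H : ℝ → ℝ be increasing, convex and locally Lipschitz with H(x) = 0 for x ≤ 0. For γ > 0, let r_γ : [0,M] → ℝ be a continuous solution of the impact Volterra equation r_γ(t) = H(κ ∫₀ᵗ λ⁻¹ (t−s)^{−α} (γ f(s) − r_γ(s)) ds), and define MI(γ,t) = κ ∫₀ᵗ (1 + λ⁻¹ (t−s)^{−α}) (γ f(s) − r_γ(s)) ds. Then for all γ₁, γ₂ > 0, all w ∈ [0,1] and all t ∈ [0,M], MI(w γ₁ + (1−w) γ₂, t) ≥ w MI(γ₁,t) + (1−w) MI(γ₂,t); that is, γ ↦ MI(γ,t) is concave. -/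
open MeasureTheory Set Filter Topology

/-- The convolution `∫₀ᵗ (t - s)^β g(s) ds`. -/
noncomputable def abelConv (β : ℝ) (g : ℝ → ℝ) (t : ℝ) : ℝ :=
  ∫ s in (0:ℝ)..t, (t - s) ^ β * g s

lemma intervalIntegrable_sub_rpow {β : ℝ} (hβ : -1 < β) (a b t : ℝ) :
    IntervalIntegrable (fun s : ℝ => (t - s) ^ β) volume a b := by
  have h := (intervalIntegral.intervalIntegrable_rpow' (a := t - a) (b := t - b) hβ).comp_sub_left t
  simpa using h

lemma integral_sub_rpow {β : ℝ} (hβ : -1 < β) (t : ℝ) :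
    ∫ s in (0:ℝ)..t, (t - s) ^ β = t ^ (β + 1) / (β + 1) := by
  rw [intervalIntegral.integral_comp_sub_left (fun x : ℝ => x ^ β) t, integral_rpow (Or.inl hβ)]
  simp [Real.zero_rpow (by linarith : β + 1 ≠ 0)]

lemma abelConv_integrable {β : ℝ} (hβ : -1 < β) {g : ℝ → ℝ} {a b : ℝ}
    (hg : ContinuousOn g (uIcc a b)) (t : ℝ) :
    IntervalIntegrable (fun s => (t - s) ^ β * g s) volume a b :=
  (intervalIntegrable_sub_rpow hβ a b t).mul_continuousOn hg

@[simp] lemma abelConv_zero (β : ℝ) (g : ℝ → ℝ) : abelConv β g 0 = 0 := by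
  simp [abelConv]

lemma abelConv_eq_scaled {β : ℝ} (hβ : -1 < β) (g : ℝ → ℝ) {t : ℝ} (ht : 0 ≤ t) :
    abelConv β g t = t ^ (β + 1) * ∫ v in (0:ℝ)..1, (1 - v) ^ β * g (t * v) := by
  rcases ht.eq_or_lt with rfl | ht
  · simp [Real.zero_rpow (by linarith : β + 1 ≠ 0)]
  have h := intervalIntegral.smul_integral_comp_mul_add
    (fun s => (t - s) ^ β * g s) t 0 (a := 0) (b := 1)
  simp only [mul_zero, add_zero, mul_one, smul_eq_mul] at h
  rw [abelConv, ← h, Real.rpow_add ht, Real.rpow_one, mul_comm (t ^ β), mul_assoc]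
  congr 1
  rw [← intervalIntegral.integral_const_mul]
  refine intervalIntegral.integral_congr fun v hv => ?_
  rw [uIcc_of_le zero_le_one] at hv
  have : t - t * v = t * (1 - v) := by ring
  simp only [this]
  rw [Real.mul_rpow ht.le (by linarith [hv.2])]
  ring

lemma continuousOn_abelConv {β : ℝ} (hβ : -1 < β) {g : ℝ → ℝ} (hg : Continuous g) (M : ℝ) :
    ContinuousOn (abelConv β g) (Icc 0 M) := by
  obtain ⟨C, hC⟩ := (isCompact_Icc (a := (0:ℝ)) (b := M)).exists_bound_of_continuousOn
    hg.continuousOn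
  have hφ : ContinuousOn (fun t : ℝ => ∫ v in (0:ℝ)..1, (1 - v) ^ β * g (t * v)) (Icc 0 M) := by
    intro x hx
    refine intervalIntegral.continuousWithinAt_of_dominated_interval
      (bound := fun v => (1 - v) ^ β * C) ?_ ?_ ?_ ?_
    · filter_upwards with t
      have := abelConv_integrable hβ (g := fun v => g (t * v)) (a := 0) (b := 1)
        (by fun_prop) 1
      exact (intervalIntegrable_iff.1 this).aestronglyMeasurable
    · filter_upwards [self_mem_nhdsWithin] with t ht
      filter_upwards with v hv
      rw [uIoc_of_le zero_le_one] at hv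
      have h1 : (0:ℝ) ≤ (1 - v) ^ β := Real.rpow_nonneg (by linarith [hv.2]) _
      rw [norm_mul, Real.norm_of_nonneg h1]
      refine mul_le_mul_of_nonneg_left (hC _ ⟨mul_nonneg ht.1 hv.1.le, ?_⟩) h1
      nlinarith [ht.1, ht.2, hv.1, hv.2]
    · exact (intervalIntegrable_sub_rpow hβ 0 1 1).mul_const C
    · filter_upwards with v _
      exact (by fun_prop : Continuous fun t => (1 - v) ^ β * g (t * v)).continuousWithinAt
  have hr : Continuous fun t : ℝ => t ^ (β + 1) :=
    Real.continuous_rpow_const (by linarith)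
  exact (hr.continuousOn.mul hφ).congr fun t ht => abelConv_eq_scaled hβ g ht.1

/-- Normalising constant of the Abel kernels. -/
noncomputable def abelConst (α : ℝ) : ℝ :=
  ∫ v in (0:ℝ)..1, (1 - v) ^ (α - 1) * v ^ (-α)

lemma abelConst_pos {α : ℝ} (h0 : 0 < α) (h1 : α < 1) : 0 < abelConst α := by
  have hint : IntervalIntegrable (fun v : ℝ => (1 - v) ^ (α - 1) * v ^ (-α)) volume 0 1 := by
    have h := (Complex.betaIntegral_convergent (u := ((1 - α : ℝ) : ℂ)) (v := (α : ℂ))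
      (by simpa using h1) (by simpa using h0)).norm
    refine h.congr_uIoo ?_
    intro v hv
    rw [uIoo_of_le zero_le_one] at hv
    have e1 : ((v:ℂ) ^ (((1 - α : ℝ) : ℂ) - 1)) = ((v ^ (-α) : ℝ) : ℂ) := by
      rw [Complex.ofReal_cpow hv.1.le]; push_cast; ring_nf
    have e2 : ((1 - (v:ℂ)) ^ ((α : ℂ) - 1)) = (((1 - v) ^ (α - 1) : ℝ) : ℂ) := by
      rw [Complex.ofReal_cpow (by linarith [hv.2])]; push_cast; ring_nf
    simp only [e1, e2]
    rw [← Complex.ofReal_mul, Complex.norm_real, Real.norm_of_nonneg, mul_comm]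
    exact mul_nonneg (Real.rpow_nonneg hv.1.le _) (Real.rpow_nonneg (by linarith [hv.2]) _)
  refine intervalIntegral.intervalIntegral_pos_of_pos_on hint (fun v hv => ?_) zero_lt_one
  exact mul_pos (Real.rpow_pos_of_pos (by linarith [hv.2]) _) (Real.rpow_pos_of_pos hv.1 _)

lemma integral_abel_kernels {α u t : ℝ} (hut : u < t) :
    ∫ s in u..t, (t - s) ^ (α - 1) * (s - u) ^ (-α) = abelConst α := by
  have hc : 0 < t - u := sub_pos.2 hut
  have h := intervalIntegral.smul_integral_comp_mul_add
    (fun s => (t - s) ^ (α - 1) * (s - u) ^ (-α)) (t - u) u (a := 0) (b := 1)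
  simp only [mul_zero, zero_add, mul_one, smul_eq_mul, sub_add_cancel] at h
  rw [← h, abelConst, ← intervalIntegral.integral_const_mul]
  refine intervalIntegral.integral_congr fun v hv => ?_
  rw [uIcc_of_le zero_le_one] at hv
  have e1 : t - ((t - u) * v + u) = (t - u) * (1 - v) := by ring
  have e2 : (t - u) * v + u - u = (t - u) * v := by ring
  simp only [e1, e2]
  rw [Real.mul_rpow hc.le (by linarith [hv.2]), Real.mul_rpow hc.le hv.1]
  have : (t - u) * ((t - u) ^ (α - 1) * (t - u) ^ (-α)) = 1 := by
    rw [← Real.rpow_add hc, show α - 1 + -α = -1 by ring, Real.rpow_neg_one,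
      mul_inv_cancel₀ hc.ne']
  linear_combination ((1 - v) ^ (α - 1) * v ^ (-α)) * this

lemma integrable_abel_kernels {α u t : ℝ} (h0 : 0 < α) (h1 : α < 1) (hut : u < t) :
    IntervalIntegrable (fun s => (t - s) ^ (α - 1) * (s - u) ^ (-α)) volume u t := by
  by_contra h
  have := intervalIntegral.integral_undef h
  rw [integral_abel_kernels hut] at this
  exact (abelConst_pos h0 h1).ne' this

/-- The kernels `(t - s)^(α - 1)` and `(t - s)^(-α)` convolve to a constant. -/
lemma abelConv_abelConv {α : ℝ} (h0 : 0 < α) (h1 : α < 1) {g : ℝ → ℝ} (hg : Continuous g)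
    {t : ℝ} (ht : 0 ≤ t) :
    abelConv (α - 1) (abelConv (-α) g) t = abelConst α * ∫ s in (0:ℝ)..t, g s := by
  set F : ℝ → ℝ → ℝ := fun s u =>
    (Iio s).indicator (fun u => (t - s) ^ (α - 1) * ((s - u) ^ (-α) * g u)) u with hF
  have hF' : ∀ u, (fun s => F s u) =
      (Ioi u).indicator (fun s => (t - s) ^ (α - 1) * (s - u) ^ (-α) * g u) := by
    intro u; ext s
    simp only [hF, indicator_apply, mem_Iio, mem_Ioi, mul_assoc]
  have hset : ∀ u ∈ Ioc 0 t, Ioi u ∩ Ioc 0 t = Ioc u t := by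
    intro u hu; ext s
    simp only [mem_inter_iff, mem_Ioi, mem_Ioc]
    constructor
    · rintro ⟨a, b, c⟩; exact ⟨a, c⟩
    · rintro ⟨a, c⟩; exact ⟨a, hu.1.trans a, c⟩
  have hne : ∀ᵐ u ∂(volume.restrict (Ioc 0 t)), u ∈ Ioo 0 t := by
    rw [← restrict_Ioo_eq_restrict_Ioc]
    exact ae_restrict_mem measurableSet_Ioo
  have hint : ∀ u ∈ Ioo 0 t, ∫ s in Ioc 0 t, F s u = abelConst α * g u := by
    intro u hu
    rw [hF' u, integral_indicator measurableSet_Ioi, Measure.restrict_restrict measurableSet_Ioi,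
      hset u ⟨hu.1, hu.2.le⟩, integral_mul_const, ← intervalIntegral.integral_of_le hu.2.le,
      integral_abel_kernels hu.2]
  have hintn : ∀ u ∈ Ioo 0 t, ∫ s in Ioc 0 t, ‖F s u‖ = abelConst α * |g u| := by
    intro u hu
    have : (fun s => ‖F s u‖) = fun s =>
        (Ioi u).indicator (fun s => ‖(t - s) ^ (α - 1) * (s - u) ^ (-α) * g u‖) s := by
      ext s
      rw [← norm_indicator_eq_indicator_norm]
      exact congrArg norm (congrFun (hF' u) s)
    rw [this, integral_indicator measurableSet_Ioi, Measure.restrict_restrict measurableSet_Ioi,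
      hset u ⟨hu.1, hu.2.le⟩, ← integral_abel_kernels (α := α) hu.2,
      intervalIntegral.integral_of_le hu.2.le, ← integral_mul_const]
    refine setIntegral_congr_fun measurableSet_Ioc fun s hs => ?_
    rw [norm_mul, Real.norm_of_nonneg, Real.norm_eq_abs]
    exact mul_nonneg (Real.rpow_nonneg (by linarith [hs.2]) _)
      (Real.rpow_nonneg (by linarith [hs.1]) _)
  have hmeas : Measurable (Function.uncurry F) := by
    have : Function.uncurry F = {p : ℝ × ℝ | p.2 < p.1}.indicator
        (fun p => (t - p.1) ^ (α - 1) * ((p.1 - p.2) ^ (-α) * g p.2)) := by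
      ext ⟨s, u⟩
      simp [hF, indicator_apply]
    rw [this]
    have hgm := hg.measurable
    exact Measurable.indicator (by fun_prop) (measurableSet_lt measurable_snd measurable_fst)
  have hI : Integrable (Function.uncurry F)
      ((volume.restrict (Ioc 0 t)).prod (volume.restrict (Ioc 0 t))) := by
    rw [integrable_prod_iff' hmeas.aestronglyMeasurable]
    constructor
    · filter_upwards [hne] with u hu
      change Integrable (fun s => F s u) _
      rw [hF' u, integrable_indicator_iff measurableSet_Ioi, IntegrableOn,
        Measure.restrict_restrict measurableSet_Ioi, hset u ⟨hu.1, hu.2.le⟩]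
      exact ((intervalIntegrable_iff_integrableOn_Ioc_of_le hu.2.le).1
        (integrable_abel_kernels h0 h1 hu.2)).mul_const _
    · have hc : Integrable (fun u => abelConst α * |g u|) (volume.restrict (Ioc 0 t)) :=
        ((continuous_const.mul hg.abs).continuousOn.integrableOn_Icc).mono_set Ioc_subset_Icc_self
      refine hc.congr ?_
      filter_upwards [hne] with u hu
      exact (hintn u hu).symm
  have hL : abelConv (α - 1) (abelConv (-α) g) t = ∫ s in Ioc 0 t, ∫ u in Ioc 0 t, F s u := by
    rw [abelConv, intervalIntegral.integral_of_le ht]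
    refine setIntegral_congr_fun measurableSet_Ioc fun s hs => ?_
    simp only [hF, abelConv]
    rw [integral_indicator measurableSet_Iio, Measure.restrict_restrict measurableSet_Iio,
      integral_const_mul, intervalIntegral.integral_of_le hs.1.le,
      ← restrict_Ioo_eq_restrict_Ioc]
    congr 4
    ext u
    simp only [mem_inter_iff, mem_Ioo, mem_Iio, mem_Ioc]
    constructor
    · rintro ⟨a, b⟩; exact ⟨b, a, b.le.trans hs.2⟩
    · rintro ⟨a, b, c⟩; exact ⟨b, a⟩
  rw [hL, integral_integral_swap hI, intervalIntegral.integral_of_le ht, ← integral_const_mul]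
  refine integral_congr_ae ?_
  filter_upwards [hne] with u hu
  exact hint u hu

lemma abelConv_sub_le {α : ℝ} (h0 : 0 < α) (h1 : α < 1) {g : ℝ → ℝ} (hg : Continuous g)
    {t Λ : ℝ} (ht : 0 < t)
    (hΛ : ∀ x ∈ Icc 0 t, ∀ y ∈ Icc 0 t, |g x - g y| ≤ Λ * |x - y|) :
    ∃ C, ∀ s ∈ Icc 0 t, abelConv (-α) g s - abelConv (-α) g t ≤ C * (t - s) := by
  have hα : -1 < -α := by linarith
  obtain ⟨C, hC⟩ := (isCompact_Icc (a := (0:ℝ)) (b := t)).exists_bound_of_continuousOn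
    hg.continuousOn
  set b : ℝ := ∫ v in (0:ℝ)..1, (1 - v) ^ (-α) with hb
  have hker : ∀ v ∈ Ioc (0:ℝ) 1, (0:ℝ) ≤ (1 - v) ^ (-α) := fun v hv =>
    Real.rpow_nonneg (by linarith [hv.2]) _
  have hb0 : 0 ≤ b := by
    rw [hb, intervalIntegral.integral_of_le zero_le_one]
    exact setIntegral_nonneg measurableSet_Ioc hker
  have hΛ0 : 0 ≤ Λ := by
    have h := (abs_nonneg _).trans (hΛ t ⟨ht.le, le_rfl⟩ 0 ⟨le_rfl, ht.le⟩)
    rw [sub_zero, abs_of_pos ht] at h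
    exact nonneg_of_mul_nonneg_left h ht
  have hbi : IntervalIntegrable (fun v : ℝ => (1 - v) ^ (-α)) volume 0 1 :=
    intervalIntegrable_sub_rpow hα 0 1 1
  set φ : ℝ → ℝ := fun s => ∫ v in (0:ℝ)..1, (1 - v) ^ (-α) * g (s * v) with hφ
  have hφi : ∀ s, IntervalIntegrable (fun v : ℝ => (1 - v) ^ (-α) * g (s * v)) volume 0 1 :=
    fun s => abelConv_integrable hα (by fun_prop) 1
  have hmem : ∀ s ∈ Icc 0 t, ∀ v ∈ Ioc (0:ℝ) 1, s * v ∈ Icc 0 t := fun s hs v hv =>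
    ⟨mul_nonneg hs.1 hv.1.le, by nlinarith [hs.1, hs.2, hv.1, hv.2]⟩
  have hφt : |φ t| ≤ b * C := by
    rw [hb, ← intervalIntegral.integral_mul_const, ← Real.norm_eq_abs]
    refine intervalIntegral.norm_integral_le_of_norm_le zero_le_one ?_ (hbi.mul_const C)
    filter_upwards with v hv
    rw [norm_mul, Real.norm_of_nonneg (hker v hv)]
    exact mul_le_mul_of_nonneg_left (hC _ (hmem t ⟨ht.le, le_rfl⟩ v hv)) (hker v hv)
  have hφs : ∀ s ∈ Icc 0 t, |φ s - φ t| ≤ b * (Λ * (t - s)) := by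
    intro s hs
    rw [hφ]
    simp only
    rw [← intervalIntegral.integral_sub (hφi s) (hφi t), hb,
      ← intervalIntegral.integral_mul_const, ← Real.norm_eq_abs]
    refine intervalIntegral.norm_integral_le_of_norm_le zero_le_one ?_ (hbi.mul_const _)
    filter_upwards with v hv
    rw [← mul_sub, norm_mul, Real.norm_of_nonneg (hker v hv)]
    refine mul_le_mul_of_nonneg_left ?_ (hker v hv)
    refine (hΛ _ (hmem s hs v hv) _ (hmem t ⟨ht.le, le_rfl⟩ v hv)).trans
      (mul_le_mul_of_nonneg_left ?_ hΛ0)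
    rw [← sub_mul, abs_mul, abs_of_pos hv.1, abs_sub_comm, abs_of_nonneg (sub_nonneg.2 hs.2)]
    exact mul_le_of_le_one_right (sub_nonneg.2 hs.2) hv.2
  refine ⟨t ^ (-α + 1) * (b * Λ) + t ^ (-α) * (b * C), fun s hs => ?_⟩
  have hts : 0 ≤ t - s := sub_nonneg.2 hs.2
  have hpow1 : s ^ (-α + 1) ≤ t ^ (-α + 1) :=
    Real.rpow_le_rpow hs.1 hs.2 (by linarith)
  have hpow2 : t ^ (-α + 1) - s ^ (-α + 1) ≤ t ^ (-α) * (t - s) := by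
    have ht' : t ^ (-α + 1) = t ^ (-α) * t := by rw [Real.rpow_add ht, Real.rpow_one]
    have hs' : t ^ (-α) * s ≤ s ^ (-α + 1) := by
      rcases hs.1.eq_or_lt with h | h
      · simp [← h, Real.zero_rpow (by linarith : -α + 1 ≠ 0)]
      · rw [Real.rpow_add h, Real.rpow_one]
        exact mul_le_mul_of_nonneg_right
          (Real.rpow_le_rpow_of_nonpos h hs.2 (by linarith)) h.le
    rw [ht', mul_sub]; linarith
  rw [abelConv_eq_scaled hα g hs.1, abelConv_eq_scaled hα g ht.le]
  change s ^ (-α + 1) * φ s - t ^ (-α + 1) * φ t ≤ _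
  have e : s ^ (-α + 1) * φ s - t ^ (-α + 1) * φ t
      = s ^ (-α + 1) * (φ s - φ t) + (t ^ (-α + 1) - s ^ (-α + 1)) * (-φ t) := by ring
  have i1 : s ^ (-α + 1) * (φ s - φ t) ≤ t ^ (-α + 1) * (b * (Λ * (t - s))) :=
    (mul_le_mul_of_nonneg_left ((le_abs_self _).trans (hφs s hs)) (Real.rpow_nonneg hs.1 _)).trans
      (mul_le_mul_of_nonneg_right hpow1 (by positivity))
  have i2 : (t ^ (-α + 1) - s ^ (-α + 1)) * (-φ t) ≤ t ^ (-α) * (t - s) * (b * C) :=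
    (mul_le_mul_of_nonneg_left ((neg_le_abs _).trans hφt) (sub_nonneg.2 hpow1)).trans
      (mul_le_mul_of_nonneg_right hpow2 ((abs_nonneg _).trans hφt))
  rw [e]
  linarith

lemma sub_rpow_le {α t h : ℝ} (h0 : 0 < α) (h1 : α < 1) (ht : 0 < t) (hht : h ≤ t) :
    (t - h) ^ α ≤ t ^ α - α * h * t ^ (α - 1) := by
  have hb := rpow_one_add_le_one_add_mul_self (s := -(h / t))
    (by rw [neg_le_neg_iff, div_le_one ht]; exact hht) h0.le h1.le
  have e : t - h = t * (1 + -(h / t)) := by field_simp; ring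
  have hn : 0 ≤ 1 + -(h / t) := by
    have := (div_le_one ht).2 hht
    linarith
  rw [e, Real.mul_rpow ht.le hn, Real.rpow_sub_one ht.ne']
  calc t ^ α * (1 + -(h / t)) ^ α ≤ t ^ α * (1 + α * -(h / t)) :=
        mul_le_mul_of_nonneg_left hb (Real.rpow_nonneg ht.le _)
    _ = _ := by ring

/-- Extremum principle for the Abel operator: at a nonpositive minimum of `abelConv (-α) g`,
the function `g` is bounded above by a multiple of the minimum. -/
lemma abel_extremum {α : ℝ} (h0 : 0 < α) (h1 : α < 1) {g : ℝ → ℝ} (hg : Continuous g)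
    {t Λ : ℝ} (ht : 0 < t)
    (hΛ : ∀ x ∈ Icc 0 t, ∀ y ∈ Icc 0 t, |g x - g y| ≤ Λ * |x - y|)
    (hmin : ∀ s ∈ Icc 0 t, abelConv (-α) g t ≤ abelConv (-α) g s)
    (hneg : abelConv (-α) g t ≤ 0) :
    abelConst α * g t ≤ abelConv (-α) g t * t ^ (α - 1) := by
  have hα : -1 < -α := by linarith
  have hα' : -1 < α - 1 := by linarith
  obtain ⟨C, hC⟩ := abelConv_sub_le h0 h1 hg ht hΛ
  set Z := abelConv (-α) g with hZ
  set m := Z t with hm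
  set B := abelConst α with hB
  have hB0 : 0 < B := abelConst_pos h0 h1
  have hC0 : 0 ≤ C := by
    have h := (sub_nonneg.2 (hmin 0 ⟨le_rfl, ht.le⟩)).trans (hC 0 ⟨le_rfl, ht.le⟩)
    rw [sub_zero] at h
    exact nonneg_of_mul_nonneg_left h ht
  have hZc : ContinuousOn Z (Icc 0 t) := continuousOn_abelConv hα hg t
  have hWi : ∀ a b x, 0 ≤ a → a ≤ b → b ≤ t →
      IntervalIntegrable (fun s => (x - s) ^ (α - 1) * (Z s - m)) volume a b := by
    intro a b x ha hab hb
    refine abelConv_integrable hα' ?_ x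
    rw [uIcc_of_le hab]
    exact (hZc.mono (Icc_subset_Icc ha hb)).sub continuousOn_const
  have hsplit : ∀ x ∈ Icc 0 t, B * ∫ s in (0:ℝ)..x, g s
      = (∫ s in (0:ℝ)..x, (x - s) ^ (α - 1) * (Z s - m)) + m * (x ^ α / α) := by
    intro x hx
    rw [← abelConv_abelConv h0 h1 hg hx.1, abelConv]
    have e := integral_sub_rpow hα' x
    rw [sub_add_cancel] at e
    rw [← e, mul_comm m, ← intervalIntegral.integral_mul_const,
      ← intervalIntegral.integral_add (hWi 0 x x le_rfl hx.1 hx.2)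
        ((intervalIntegrable_sub_rpow hα' 0 x x).mul_const m)]
    refine intervalIntegral.integral_congr fun s _ => ?_
    ring
  have key : ∀ h ∈ Ioo 0 t, B * g t ≤ m * t ^ (α - 1) + B * (Λ * h) + C * h ^ α := by
    intro h hh
    have hth : t - h ∈ Icc 0 t := ⟨by linarith [hh.2], by linarith [hh.1]⟩
    have s1 := hsplit t ⟨ht.le, le_rfl⟩
    have s2 := hsplit (t - h) hth
    have hadd := intervalIntegral.integral_add_adjacent_intervals
      (hWi 0 (t - h) t le_rfl hth.1 hth.2) (hWi (t - h) t t hth.1 hth.2 le_rfl)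
    have hgadd := intervalIntegral.integral_add_adjacent_intervals
      (hg.intervalIntegrable (μ := volume) 0 (t - h)) (hg.intervalIntegrable (t - h) t)
    have j1 : ∫ s in (0:ℝ)..(t - h), (t - s) ^ (α - 1) * (Z s - m)
        ≤ ∫ s in (0:ℝ)..(t - h), (t - h - s) ^ (α - 1) * (Z s - m) := by
      refine intervalIntegral.integral_mono_on_of_le_Ioo hth.1
        (hWi _ _ _ le_rfl hth.1 hth.2) (hWi _ _ _ le_rfl hth.1 hth.2) fun s hs => ?_
      refine mul_le_mul_of_nonneg_right ?_
        (sub_nonneg.2 (hmin s ⟨hs.1.le, by linarith [hs.2, hh.1]⟩))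
      exact Real.rpow_le_rpow_of_nonpos (by linarith [hs.2]) (by linarith [hh.1]) (by linarith)
    have j2 : ∫ s in (t - h)..t, (t - s) ^ (α - 1) * (Z s - m) ≤ C * h ^ α * h := by
      have hn := intervalIntegral.norm_integral_le_of_norm_le_const (a := t - h) (b := t)
        (f := fun s => (t - s) ^ (α - 1) * (Z s - m)) (C := C * h ^ α) ?_
      · rw [sub_sub_cancel, abs_of_pos hh.1] at hn
        exact (le_abs_self _).trans hn
      · intro s hs
        rw [uIoc_of_le hth.2] at hs
        have hs' : s ∈ Icc 0 t := ⟨hth.1.trans hs.1.le, hs.2⟩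
        have hts : 0 ≤ t - s := sub_nonneg.2 hs.2
        rw [norm_mul, Real.norm_of_nonneg (Real.rpow_nonneg hts _),
          Real.norm_of_nonneg (sub_nonneg.2 (hmin s hs'))]
        calc (t - s) ^ (α - 1) * (Z s - m) ≤ (t - s) ^ (α - 1) * (C * (t - s)) :=
              mul_le_mul_of_nonneg_left (hC s hs') (Real.rpow_nonneg hts _)
          _ = C * (t - s) ^ α := by
              rcases hts.eq_or_lt with h | h
              · simp [← h, Real.zero_rpow h0.ne']
              · rw [Real.rpow_sub_one h.ne']; field_simp
          _ ≤ C * h ^ α := mul_le_mul_of_nonneg_left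
              (Real.rpow_le_rpow hts (by linarith [hs.1]) h0.le) hC0
    have j3 : h * (g t - Λ * h) ≤ ∫ s in (t - h)..t, g s := by
      have hc : ∫ s in (t - h)..t, (g t - Λ * h) = h * (g t - Λ * h) := by
        rw [intervalIntegral.integral_const, sub_sub_cancel, smul_eq_mul]
      rw [← hc]
      refine intervalIntegral.integral_mono_on hth.2 intervalIntegrable_const
        (hg.intervalIntegrable _ _) fun s hs => ?_
      have hs' : s ∈ Icc 0 t := ⟨hth.1.trans hs.1, hs.2⟩
      have hl := hΛ t ⟨ht.le, le_rfl⟩ s hs'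
      have hΛ0 : 0 ≤ Λ := by
        have h := (abs_nonneg _).trans (hΛ t ⟨ht.le, le_rfl⟩ 0 ⟨le_rfl, ht.le⟩)
        rw [sub_zero, abs_of_pos ht] at h
        exact nonneg_of_mul_nonneg_left h ht
      rw [abs_of_nonneg (sub_nonneg.2 hs.2)] at hl
      have := mul_le_mul_of_nonneg_left (by linarith [hs.1] : t - s ≤ h) hΛ0
      linarith [le_abs_self (g t - g s)]
    have j4 : m * (t ^ α / α) - m * ((t - h) ^ α / α) ≤ m * (h * t ^ (α - 1)) := by
      rw [← mul_sub]
      refine mul_le_mul_of_nonpos_left ?_ hneg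
      rw [← sub_div, le_div_iff₀ h0]
      linarith [sub_rpow_le h0 h1 ht hh.2.le]
    have j5 := mul_le_mul_of_nonneg_left j3 hB0.le
    have : h * (B * g t) ≤ h * (m * t ^ (α - 1) + B * (Λ * h) + C * h ^ α) := by
      rw [← hgadd, mul_add] at s1
      linarith
    exact le_of_mul_le_mul_left this hh.1
  have hlim : Tendsto (fun h : ℝ => m * t ^ (α - 1) + B * (Λ * h) + C * h ^ α) (𝓝[>] 0)
      (𝓝 (m * t ^ (α - 1))) := by
    have hc : Continuous fun h : ℝ => m * t ^ (α - 1) + B * (Λ * h) + C * h ^ α := by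
      have := Real.continuous_rpow_const h0.le
      fun_prop
    have := (hc.tendsto 0).mono_left (nhdsWithin_le_nhds (s := Ioi 0))
    simpa [Real.zero_rpow h0.ne'] using this
  refine ge_of_tendsto hlim ?_
  filter_upwards [Ioo_mem_nhdsGT ht] with h hh
  exact key h hh

lemma exists_polynomial_lipschitz (p : Polynomial ℝ) (M : ℝ) :
    ∃ Λ, ∀ x ∈ Icc 0 M, ∀ y ∈ Icc 0 M, |p.eval x - p.eval y| ≤ Λ * |x - y| := by
  obtain ⟨Λ, hΛ⟩ := (isCompact_Icc (a := (0:ℝ)) (b := M)).exists_bound_of_continuousOn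
    p.derivative.continuous.continuousOn
  refine ⟨Λ, fun x hx y hy => ?_⟩
  exact Convex.norm_image_sub_le_of_norm_deriv_le (f := fun x => p.eval x) (s := Icc 0 M)
    (fun z _ => p.differentiableAt) (fun z hz => by simpa using hΛ z hz) (convex_Icc 0 M) hy hx

lemma abs_abelConv_sub_le {β : ℝ} (hβ : -1 < β) {g k : ℝ → ℝ} (hg : Continuous g)
    (hk : Continuous k) {M ε t : ℝ} (hε : 0 ≤ ε) (ht : t ∈ Icc 0 M)
    (hgk : ∀ s ∈ Icc 0 M, |g s - k s| ≤ ε) :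
    |abelConv β g t - abelConv β k t| ≤ M ^ (β + 1) / (β + 1) * ε := by
  have hi := intervalIntegrable_sub_rpow hβ 0 t t
  have h : |abelConv β g t - abelConv β k t| ≤ ∫ s in (0:ℝ)..t, (t - s) ^ β * ε := by
    rw [abelConv, abelConv, ← intervalIntegral.integral_sub
      (abelConv_integrable hβ hg.continuousOn t) (abelConv_integrable hβ hk.continuousOn t),
      ← Real.norm_eq_abs]
    refine intervalIntegral.norm_integral_le_of_norm_le ht.1 ?_ (hi.mul_const ε)
    filter_upwards with s hs
    have hn : (0:ℝ) ≤ (t - s) ^ β := Real.rpow_nonneg (by linarith [hs.2]) _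
    rw [← mul_sub, norm_mul, Real.norm_of_nonneg hn]
    exact mul_le_mul_of_nonneg_left (hgk s ⟨hs.1.le, hs.2.trans ht.2⟩) hn
  rw [intervalIntegral.integral_mul_const, integral_sub_rpow hβ] at h
  refine h.trans (mul_le_mul_of_nonneg_right ?_ hε)
  have hβ' : 0 < β + 1 := by linarith
  exact div_le_div_of_nonneg_right (Real.rpow_le_rpow ht.1 ht.2 hβ'.le) hβ'.le

/-- If `g` is nonnegative wherever its Abel transform is negative, the Abel transform is
nonnegative. -/
lemma abelConv_nonneg {α : ℝ} (h0 : 0 < α) (h1 : α < 1) {g : ℝ → ℝ} (hg : Continuous g)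
    {M : ℝ} (hM : 0 < M) (hsign : ∀ t ∈ Icc 0 M, abelConv (-α) g t < 0 → 0 ≤ g t) :
    ∀ t ∈ Icc 0 M, 0 ≤ abelConv (-α) g t := by
  intro t ht
  by_contra! hlt
  have hα : -1 < -α := by linarith
  have hB0 : 0 < abelConst α := abelConst_pos h0 h1
  have hα1 : 0 < -α + 1 := by linarith
  have hN : 0 < M ^ (-α + 1) / (-α + 1) := div_pos (Real.rpow_pos_of_pos hM _) hα1
  have hMp : 0 < M ^ (α - 1) := Real.rpow_pos_of_pos hM _
  set B := abelConst α
  set N := M ^ (-α + 1) / (-α + 1)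
  set η := -abelConv (-α) g t with hη
  have hη0 : 0 < η := by linarith
  obtain ⟨ε, hε0, hεN, hεB⟩ : ∃ ε, 0 < ε ∧ N * ε < η / 2 ∧ B * ε < η / 2 * M ^ (α - 1) := by
    refine ⟨min (η / (4 * N)) (η * M ^ (α - 1) / (4 * B)), by positivity, ?_, ?_⟩
    · calc N * _ ≤ N * (η / (4 * N)) := mul_le_mul_of_nonneg_left (min_le_left _ _) hN.le
        _ = η / 4 := by field_simp
        _ < η / 2 := by linarith
    · calc B * _ ≤ B * (η * M ^ (α - 1) / (4 * B)) :=
            mul_le_mul_of_nonneg_left (min_le_right _ _) hB0.le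
        _ = η * M ^ (α - 1) / 4 := by field_simp
        _ < η / 2 * M ^ (α - 1) := by nlinarith [mul_pos hη0 hMp]
  obtain ⟨p, hp⟩ := exists_polynomial_near_of_continuousOn 0 M g hg.continuousOn ε hε0
  have hclose : ∀ s ∈ Icc 0 M,
      |abelConv (-α) (fun x => p.eval x) s - abelConv (-α) g s| ≤ N * ε := fun s hs =>
    abs_abelConv_sub_le hα p.continuous hg hε0.le hs fun x hx => (hp x hx).le
  obtain ⟨τ, hτ, hτmin⟩ := (isCompact_Icc (a := (0:ℝ)) (b := M)).exists_isMinOn ⟨t, ht⟩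
    (continuousOn_abelConv hα p.continuous M)
  have hmt : abelConv (-α) (fun x => p.eval x) τ < -(η / 2) := by
    have a := isMinOn_iff.1 hτmin t ht
    have b := (abs_le.1 (hclose t ht)).2
    linarith
  have hτ0 : 0 < τ := by
    refine hτ.1.lt_of_ne fun h => ?_
    rw [← h, abelConv_zero] at hmt
    linarith
  have hgτ : 0 ≤ g τ := by
    refine hsign τ hτ ?_
    have b := (abs_le.1 (hclose τ hτ)).1
    linarith
  obtain ⟨Λ, hΛ⟩ := exists_polynomial_lipschitz p M
  have hsub : Icc 0 τ ⊆ Icc 0 M := Icc_subset_Icc_right hτ.2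
  have hext := abel_extremum h0 h1 p.continuous hτ0
    (fun x hx y hy => hΛ x (hsub hx) y (hsub hy))
    (fun s hs => isMinOn_iff.1 hτmin s (hsub hs)) (by linarith)
  have hpow : M ^ (α - 1) ≤ τ ^ (α - 1) := Real.rpow_le_rpow_of_nonpos hτ0 hτ.2 (by linarith)
  have hpτ : -ε ≤ p.eval τ := by linarith [(abs_lt.1 (hp τ hτ)).1]
  have k1 := mul_le_mul_of_nonneg_left hpτ hB0.le
  have k2 : abelConv (-α) (fun x => p.eval x) τ * τ ^ (α - 1) ≤ -(η / 2) * M ^ (α - 1) :=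
    (mul_le_mul_of_nonneg_right hmt.le (hMp.le.trans hpow)).trans
      (mul_le_mul_of_nonpos_left hpow (by linarith))
  linarith

lemma integral_nonneg_of_abelConv_nonneg {α : ℝ} (h0 : 0 < α) (h1 : α < 1) {g : ℝ → ℝ}
    (hg : Continuous g) {t : ℝ} (ht : 0 ≤ t) (h : ∀ s ∈ Icc 0 t, 0 ≤ abelConv (-α) g s) :
    0 ≤ ∫ s in (0:ℝ)..t, g s := by
  refine nonneg_of_mul_nonneg_right ?_ (abelConst_pos h0 h1)
  rw [← abelConv_abelConv h0 h1 hg ht]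
  exact intervalIntegral.integral_nonneg ht fun s hs =>
    mul_nonneg (Real.rpow_nonneg (by linarith [hs.2]) _) (h s hs)

lemma IntervalIntegrable.mul_of_bounded {k f : ℝ → ℝ} {t C : ℝ} (ht : 0 ≤ t)
    (hk : IntervalIntegrable k volume 0 t) (hf : Measurable f) (hC : ∀ s, 0 ≤ s → ‖f s‖ ≤ C) :
    IntervalIntegrable (fun s => k s * f s) volume 0 t := by
  rw [intervalIntegrable_iff_integrableOn_Ioc_of_le ht] at hk ⊢
  refine Integrable.mul_bdd (c := C) hk hf.aestronglyMeasurable ?_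
  filter_upwards [ae_restrict_mem measurableSet_Ioc] with s hs
  exact hC s hs.1.le

lemma integral_kernel_combination {k f r₁ r₂ rw g : ℝ → ℝ} {γ₁ γ₂ w t : ℝ}
    (hf : IntervalIntegrable (fun s => k s * f s) volume 0 t)
    (h₁ : IntervalIntegrable (fun s => k s * r₁ s) volume 0 t)
    (h₂ : IntervalIntegrable (fun s => k s * r₂ s) volume 0 t)
    (hg : IntervalIntegrable (fun s => k s * g s) volume 0 t)
    (hgr : ∀ s ∈ uIcc 0 t, g s = w * r₁ s + (1 - w) * r₂ s - rw s) :
    ∫ s in (0:ℝ)..t, k s * ((w * γ₁ + (1 - w) * γ₂) * f s - rw s)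
      = w * (∫ s in (0:ℝ)..t, k s * (γ₁ * f s - r₁ s))
        + (1 - w) * (∫ s in (0:ℝ)..t, k s * (γ₂ * f s - r₂ s))
        + ∫ s in (0:ℝ)..t, k s * g s := by
  have hi : ∀ (γ : ℝ) {r : ℝ → ℝ}, IntervalIntegrable (fun s => k s * r s) volume 0 t →
      IntervalIntegrable (fun s => k s * (γ * f s - r s)) volume 0 t := by
    intro γ r hr
    refine ((hf.const_mul γ).sub hr).congr fun s _ => ?_
    ring
  rw [← intervalIntegral.integral_const_mul, ← intervalIntegral.integral_const_mul,
    ← intervalIntegral.integral_add ((hi γ₁ h₁).const_mul w) ((hi γ₂ h₂).const_mul (1 - w)),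
    ← intervalIntegral.integral_add
      (((hi γ₁ h₁).const_mul w).add ((hi γ₂ h₂).const_mul (1 - w))) hg]
  refine intervalIntegral.integral_congr fun s hs => ?_
  rw [hgr s hs]
  ring

/-- Concavity of the macroscopic market impact in the participation rate:
for convex increasing `H`,
`MI(w γ₁ + (1−w) γ₂, t) ≥ w MI(γ₁, t) + (1−w) MI(γ₂, t)`. -/
theorem stmt_11
    (α lam κ M : ℝ) (hα0 : 0 < α) (hα1 : α < 1) (hlam : 0 < lam)
    (hκ : 0 < κ) (hM : 0 < M)
    (f : ℝ → ℝ) (hf_meas : Measurable f)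
    (hf_nonneg : ∀ t, 0 ≤ t → 0 ≤ f t)
    (hf_bdd : ∃ C, ∀ t, 0 ≤ t → f t ≤ C)
    (H : ℝ → ℝ) (hH_mono : Monotone H) (hH_conv : ConvexOn ℝ univ H)
    (hH_lip : LocallyLipschitz H)
    (hH_zero : ∀ x, x ≤ 0 → H x = 0)
    (γ₁ γ₂ w : ℝ) (hγ₁ : 0 < γ₁) (hγ₂ : 0 < γ₂) (hw0 : 0 ≤ w) (hw1 : w ≤ 1)
    (r₁ r₂ rw : ℝ → ℝ)
    (hr₁_cont : ContinuousOn r₁ (Icc 0 M))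
    (hr₂_cont : ContinuousOn r₂ (Icc 0 M))
    (hrw_cont : ContinuousOn rw (Icc 0 M))
    (hr₁ : ∀ t ∈ Icc (0:ℝ) M,
      r₁ t = H (κ * ∫ s in (0:ℝ)..t, lam⁻¹ * (t - s) ^ (-α) * (γ₁ * f s - r₁ s)))
    (hr₂ : ∀ t ∈ Icc (0:ℝ) M,
      r₂ t = H (κ * ∫ s in (0:ℝ)..t, lam⁻¹ * (t - s) ^ (-α) * (γ₂ * f s - r₂ s)))
    (hrw : ∀ t ∈ Icc (0:ℝ) M,
      rw t = H (κ * ∫ s in (0:ℝ)..t,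
        lam⁻¹ * (t - s) ^ (-α) * ((w * γ₁ + (1 - w) * γ₂) * f s - rw s))) :
    ∀ t ∈ Icc (0:ℝ) M,
      w * (κ * ∫ s in (0:ℝ)..t, (1 + lam⁻¹ * (t - s) ^ (-α)) * (γ₁ * f s - r₁ s))
        + (1 - w) *
          (κ * ∫ s in (0:ℝ)..t, (1 + lam⁻¹ * (t - s) ^ (-α)) * (γ₂ * f s - r₂ s))
      ≤ κ * ∫ s in (0:ℝ)..t,
          (1 + lam⁻¹ * (t - s) ^ (-α)) * ((w * γ₁ + (1 - w) * γ₂) * f s - rw s) := by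
  obtain ⟨C, hC⟩ := hf_bdd
  have hfC : ∀ s, 0 ≤ s → ‖f s‖ ≤ C := fun s hs => by
    rw [Real.norm_of_nonneg (hf_nonneg s hs)]
    exact hC s hs
  have hα : -1 < -α := by linarith
  have hd : ContinuousOn (fun s => w * r₁ s + (1 - w) * r₂ s - rw s) (Icc 0 M) := by
    fun_prop
  obtain ⟨g, hg, hgr⟩ : ∃ g : ℝ → ℝ, Continuous g ∧
      ∀ s ∈ Icc 0 M, g s = w * r₁ s + (1 - w) * r₂ s - rw s :=
    ⟨IccExtend hM.le ((Icc 0 M).domRestrict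
      fun s => w * r₁ s + (1 - w) * r₂ s - rw s), hd.domRestrict.Icc_extend',
      fun s hs => IccExtend_of_mem hM.le _ hs⟩
  have hker : ∀ t, IntervalIntegrable (fun s => lam⁻¹ * (t - s) ^ (-α)) volume 0 t := fun t =>
    (intervalIntegrable_sub_rpow hα 0 t t).const_mul _
  have hcomb : ∀ t ∈ Icc 0 M, ∀ k : ℝ → ℝ, IntervalIntegrable k volume 0 t →
      ∫ s in (0:ℝ)..t, k s * ((w * γ₁ + (1 - w) * γ₂) * f s - rw s)
        = w * (∫ s in (0:ℝ)..t, k s * (γ₁ * f s - r₁ s))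
          + (1 - w) * (∫ s in (0:ℝ)..t, k s * (γ₂ * f s - r₂ s))
          + ∫ s in (0:ℝ)..t, k s * g s := by
    intro t ht k hk
    have hsub : uIcc 0 t ⊆ Icc 0 M := by
      rw [uIcc_of_le ht.1]
      exact Icc_subset_Icc_right ht.2
    exact integral_kernel_combination (hk.mul_of_bounded ht.1 hf_meas hfC)
      (hk.mul_continuousOn (hr₁_cont.mono hsub)) (hk.mul_continuousOn (hr₂_cont.mono hsub))
      (hk.mul_continuousOn hg.continuousOn) fun s hs => hgr s (hsub hs)
  have habel : ∀ t, ∫ s in (0:ℝ)..t, lam⁻¹ * (t - s) ^ (-α) * g s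
      = lam⁻¹ * abelConv (-α) g t := by
    intro t
    rw [abelConv, ← intervalIntegral.integral_const_mul]
    simp only [mul_assoc]
  have hnonneg : ∀ t ∈ Icc 0 M, 0 ≤ abelConv (-α) g t := by
    refine abelConv_nonneg hα0 hα1 hg hM fun t ht hneg => ?_
    have hle : rw t ≤ w * r₁ t + (1 - w) * r₂ t := by
      rw [hrw t ht, hr₁ t ht, hr₂ t ht]
      refine (hH_mono ?_).trans
        (hH_conv.2 (mem_univ _) (mem_univ _) hw0 (sub_nonneg.2 hw1) (by ring))
      rw [hcomb t ht _ (hker t), habel t, smul_eq_mul, smul_eq_mul]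
      have := mul_neg_of_pos_of_neg (mul_pos hκ (inv_pos.2 hlam)) hneg
      linarith
    rw [hgr t ht]
    linarith
  intro t ht
  have hprim := integral_nonneg_of_abelConv_nonneg hα0 hα1 hg ht.1 fun s hs =>
    hnonneg s ⟨hs.1, hs.2.trans ht.2⟩
  have hsum : ∫ s in (0:ℝ)..t, (1 + lam⁻¹ * (t - s) ^ (-α)) * g s
      = (∫ s in (0:ℝ)..t, g s) + lam⁻¹ * abelConv (-α) g t := by
    rw [← habel t, ← intervalIntegral.integral_add (hg.intervalIntegrable _ _)
      ((hker t).mul_continuousOn hg.continuousOn)]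
    simp only [add_mul, one_mul]
  rw [hcomb t ht _ (intervalIntegrable_const.add (hker t)), hsum]
  have := mul_nonneg hκ.le
    (add_nonneg hprim (mul_nonneg (inv_pos.2 hlam).le (hnonneg t ht)))
  linarith
end
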